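/- arXiv:2208.05904 — 2 statements merged into one kernel-verified Lean document; each statement's English description precedes it below -/
import Mathlib

section
/- The set c₀ of real sequences converging to 0 is strongly lower porous as a subset of the metric space ĉ₀ of sequences almost convergent to 0 (with the metric induced by the supremum norm). -/
open Filter
open scoped ENNReal Topology

noncomputable section

/-- `ℓ∞`: the Banach space of bounded real sequences with the supremum norm. -/
abbrev LInf : Type := lp (fun _ : ℕ => ℝ) ∞

/-- `x` is almost convergent to `s`: the window means `(x_j + ⋯ + x_{j+n-1})/n` tend to `s`
uniformly in `j`. -/
def AlmostConvTo (x : ℕ → ℝ) (s : ℝ) : Prop :=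
  TendstoUniformly (fun (n : ℕ) (j : ℕ) => (∑ i ∈ Finset.range n, x (j + i)) / n)
    (fun _ => s) atTop

/-- `γ(x,R,E) = sup {r > 0 : ∃ z, B(z,r) ⊆ B(x,R) \ E}`. -/
noncomputable def porGamma {X : Type*} [PseudoMetricSpace X] (x : X) (R : ℝ) (E : Set X) :
    ℝ :=
  sSup {r : ℝ | 0 < r ∧ ∃ z : X, Metric.ball z r ⊆ Metric.ball x R \ E}

/-- `E` is strongly lower porous: at every point `x ∈ E` the lower porosity
`2 · liminf_{R → 0⁺} γ(x,R,E)/R` equals `1`. -/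
def StronglyLowerPorous {X : Type*} [PseudoMetricSpace X] (E : Set X) : Prop :=
  ∀ x ∈ E, 2 * liminf (fun R : ℝ => porGamma x R E / R) (𝓝[>] 0) = 1

/-- `ĉ₀`, the metric space of sequences almost convergent to `0`, with the sup-norm metric. -/
abbrev cHatZero : Type := {y : LInf // AlmostConvTo (fun n => y n) 0}

lemma almostConv_comb {x y : ℕ → ℝ} (hx : AlmostConvTo x 0) (hy : AlmostConvTo y 0) (a b : ℝ) :
    AlmostConvTo (fun n => a * x n + b * y n) 0 := by
  unfold AlmostConvTo at *
  have h1 := (uniformContinuous_const_smul a).comp_tendstoUniformly hx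
  have h2 := (uniformContinuous_const_smul b).comp_tendstoUniformly hy
  have h3 := h1.add h2
  convert h3 using 1
  · ext n j
    simp only [Pi.add_apply, Function.comp_apply, smul_eq_mul, Finset.sum_add_distrib,
      ← Finset.mul_sum]
    ring
  · ext j
    simp

lemma alt_sum_bound (j n : ℕ) : |∑ i ∈ Finset.range n, (-1 : ℝ) ^ (j + i)| ≤ 1 := by
  simp only [pow_add, ← Finset.mul_sum, abs_mul, abs_pow, abs_neg, abs_one, one_pow, one_mul]
  rw [neg_one_geom_sum]
  split_ifs <;> simp

lemma almostConv_alt : AlmostConvTo (fun n => (-1 : ℝ) ^ n) 0 := by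
  unfold AlmostConvTo
  rw [Metric.tendstoUniformly_iff]
  intro e he
  have h := (tendsto_const_div_atTop_nhds_zero_nat (1 : ℝ)).eventually (gt_mem_nhds he)
  filter_upwards [h] with n hn j
  rw [dist_zero_left, Real.norm_eq_abs, abs_div, Nat.abs_cast]
  refine lt_of_le_of_lt ?_ hn
  gcongr
  exact alt_sum_bound j n

/-- The alternating sequence as an element of the space. -/
def altSeq : LInf := ⟨fun n => (-1 : ℝ) ^ n, by
  apply memℓp_infty
  refine ⟨1, ?_⟩
  rintro _ ⟨n, rfl⟩
  simp⟩

lemma altSeq_apply (n : ℕ) : altSeq n = (-1 : ℝ) ^ n := rfl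

lemma altSeq_norm : ‖altSeq‖ ≤ 1 := by
  apply lp.norm_le_of_forall_le zero_le_one
  intro n
  simp [altSeq_apply]

lemma comb_mem {x y : LInf} (hx : AlmostConvTo (fun n => x n) 0)
    (hy : AlmostConvTo (fun n => y n) 0) (a b : ℝ) :
    AlmostConvTo (fun n => (a • x + b • y : LInf) n) 0 := by
  exact almostConv_comb hx hy a b

lemma porGamma_eq (x : cHatZero) (hx : Tendsto (fun n : ℕ => (x : LInf) n) atTop (nhds 0))
    (R : ℝ) (hR : 0 < R) :
    porGamma x R {x : cHatZero | Tendsto (fun n : ℕ => (x : LInf) n) atTop (nhds 0)} = R / 2 := by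
  unfold porGamma
  apply IsGreatest.csSup_eq
  refine ⟨⟨by positivity, ⟨(1 : ℝ) • x.1 + (R / 2) • altSeq,
    comb_mem x.2 almostConv_alt _ _⟩, ?_⟩, ?_⟩
  · intro y hy
    rw [Metric.mem_ball, Subtype.dist_eq, dist_eq_norm] at hy
    simp only at hy
    refine ⟨?_, ?_⟩
    · rw [Metric.mem_ball, Subtype.dist_eq, dist_eq_norm]
      have h1 : y.1 - x.1 = (y.1 - ((1 : ℝ) • x.1 + (R / 2) • altSeq)) + (R / 2) • altSeq := by
        rw [one_smul]; abel
      rw [h1]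
      have h2 : ‖(R / 2) • altSeq‖ ≤ R / 2 := by
        rw [norm_smul, Real.norm_of_nonneg (by positivity)]
        have := altSeq_norm
        nlinarith
      have h3 := norm_add_le (y.1 - ((1 : ℝ) • x.1 + (R / 2) • altSeq)) ((R / 2) • altSeq)
      linarith
    · intro hyE
      rw [Set.mem_ofPred_eq] at hyE
      set d := ‖y.1 - ((1 : ℝ) • x.1 + (R / 2) • altSeq)‖ with hd
      have h0 : Tendsto (fun n : ℕ => |y.1 n - x.1 n|) atTop (nhds 0) := by
        simpa using (hyE.sub hx).abs
      obtain ⟨n, hn⟩ := (h0.eventually (gt_mem_nhds (show 0 < R / 2 - d by linarith))).exists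
      have h4 : |y.1 n - (x.1 n + (R / 2) * (-1) ^ n)| ≤ d := by
        have := lp.norm_apply_le_norm (by simp)
          (y.1 - ((1 : ℝ) • x.1 + (R / 2) • altSeq)) n
        rw [one_smul] at this
        rw [hd, one_smul]
        exact this
      have h5 : |(R / 2) * (-1 : ℝ) ^ n| = R / 2 := by
        simp [abs_mul]; positivity
      have h6 := abs_sub (y.1 n - x.1 n) (y.1 n - (x.1 n + (R / 2) * (-1) ^ n))
      rw [show (y.1 n - x.1 n) - (y.1 n - (x.1 n + (R / 2) * (-1) ^ n))
        = (R / 2) * (-1 : ℝ) ^ n by ring, h5] at h6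
      linarith
  · rintro r ⟨hr, z, hz⟩
    by_contra! hlt
    have hd : r ≤ ‖z.1 - x.1‖ := by
      by_contra! hc
      have : x ∈ Metric.ball z r := by
        rw [Metric.mem_ball, dist_comm, Subtype.dist_eq, dist_eq_norm]; exact hc
      exact (hz this).2 hx
    have hzR : ‖z.1 - x.1‖ < R := by
      have := (hz (Metric.mem_ball_self hr)).1
      rwa [Metric.mem_ball, Subtype.dist_eq, dist_eq_norm] at this
    set d := ‖z.1 - x.1‖ with hdd
    have hd0 : 0 < d := by linarith
    set s := (R - d) / d with hs
    have hs0 : 0 ≤ s := div_nonneg (by linarith) hd0.le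
    have hsd : s * d = R - d := by rw [hs]; field_simp
    let w : cHatZero := ⟨(1 + s) • z.1 + (-s) • x.1, comb_mem z.2 x.2 _ _⟩
    have hw : w ∈ Metric.ball z r := by
      rw [Metric.mem_ball, Subtype.dist_eq, dist_eq_norm]
      have : w.1 - z.1 = s • (z.1 - x.1) := by
        simp only [w]; module
      rw [this, norm_smul, Real.norm_of_nonneg hs0, ← hdd]
      linarith
    have hw2 := (hz hw).1
    rw [Metric.mem_ball, Subtype.dist_eq, dist_eq_norm] at hw2
    have : w.1 - x.1 = (1 + s) • (z.1 - x.1) := by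
      simp only [w]; module
    rw [this, norm_smul, Real.norm_of_nonneg (by linarith), ← hdd] at hw2
    linarith

/-- The set `c₀` of sequences converging to `0` is strongly lower porous in `ĉ₀`. -/
theorem stmt8 :
    StronglyLowerPorous
      {x : cHatZero | Tendsto (fun n : ℕ => (x : LInf) n) atTop (nhds 0)} := by
  intro x hx
  have h : Tendsto (fun R : ℝ => porGamma x R
      {x : cHatZero | Tendsto (fun n : ℕ => (x : LInf) n) atTop (nhds 0)} / R)
      (𝓝[>] 0) (𝓝 (1 / 2)) := by
    apply tendsto_const_nhds.congr'
    filter_upwards [self_mem_nhdsWithin] with R hR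
    have hR' : (0 : ℝ) < R := hR
    rw [porGamma_eq x hx R hR']
    field_simp
  rw [h.liminf_eq]
  norm_num
end
end

section
/- The family ℓ∞ \ S (of bounded sequences whose arithmetic means do not converge) is strongly 𝔠-algebrable in ℓ∞ with coordinatewise multiplication. -/
open Filter
open scoped ENNReal

noncomputable section

/-- `A` is strongly `𝔠`-algebrable: `A ∪ {0}` contains a free subalgebra on continuum many
generators; equivalently, there is a set `G ⊆ A ∪ {0}` of cardinality `𝔠` such that for
every `n`, every nonzero real polynomial `P` in `n` variables with zero constant term and
all distinct `g₁, …, gₙ ∈ G`, the element `P(g₁, …, gₙ)` lies in `A` and is nonzero. -/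
def StronglyContinuumAlgebrable {R : Type*} [CommRing R] [Algebra ℝ R] (A : Set R) : Prop :=
  ∃ G : Set R, G ⊆ A ∪ {0} ∧ Cardinal.mk G = Cardinal.continuum ∧
    ∀ (n : ℕ) (P : MvPolynomial (Fin n) ℝ), P ≠ 0 → MvPolynomial.coeff 0 P = 0 →
      ∀ g : Fin n → R, (∀ i, g i ∈ G) → Function.Injective g →
        MvPolynomial.aeval g P ∈ A ∧ MvPolynomial.aeval g P ≠ 0

/-- The countable index type. -/
abbrev Idx : Type := Σ m : ℕ, ((Fin m → Bool) → ℕ)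

lemma exists_surj : ∃ s : ℕ → Idx, Function.Surjective s := by
  have : Nonempty Idx := ⟨⟨0, fun _ => 0⟩⟩
  exact exists_surjective_nat Idx

/-- A surjection from the naturals. -/
def sIdx : ℕ → Idx := exists_surj.choose

lemma sIdx_surj : Function.Surjective sIdx := exists_surj.choose_spec

/-- The value of generator `a` at the index `c`. -/
def vIdx (a : ℕ → Bool) (c : Idx) : ℝ := 1 / ((c.2 (fun j => a j) : ℝ) + 1)

lemma vIdx_bd (a : ℕ → Bool) (c : Idx) : ‖vIdx a c‖ ≤ 1 := by
  unfold vIdx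
  have h : (0 : ℝ) ≤ (c.2 (fun j => a j) : ℝ) := Nat.cast_nonneg _
  rw [Real.norm_of_nonneg (by positivity), div_le_one (by positivity)]
  linarith

/-- The sequence before block expansion. -/
def ySeq (a : ℕ → Bool) (k : ℕ) : ℝ := vIdx a (sIdx (Nat.unpair k).1)

lemma ySeq_pair (a : ℕ → Bool) (q j : ℕ) (c : Idx) (hq : sIdx q = c) :
    ySeq a (Nat.pair q j) = 1 / ((c.2 (fun j => a j) : ℝ) + 1) := by
  unfold ySeq
  rw [Nat.unpair_pair, hq]
  rfl

/-- The generator. -/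
def xGen (a : ℕ → Bool) : LInf :=
  ⟨fun n => ySeq a (Nat.log 2 n), memℓp_infty ⟨1, by
    rintro _ ⟨n, rfl⟩
    exact vIdx_bd _ _⟩⟩

lemma xGen_apply (a : ℕ → Bool) (n : ℕ) : xGen a n = ySeq a (Nat.log 2 n) := rfl

lemma indep {n : ℕ} (a : Fin n → ℕ → Bool) (ha : Function.Injective a) (t : Fin n → ℕ) :
    ∃ c : Idx, ∀ i, c.2 (fun j => a i j) = t i := by
  have h : ∀ p : Fin n × Fin n, ∃ d : ℕ, p.1 ≠ p.2 → a p.1 d ≠ a p.2 d := by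
    intro p
    by_cases hp : p.1 = p.2
    · exact ⟨0, fun h => absurd hp h⟩
    · obtain ⟨d, hd⟩ := Function.ne_iff.mp (fun h => hp (ha h))
      exact ⟨d, fun _ => hd⟩
  choose d hd using h
  let m := Finset.univ.sup d + 1
  have hr : Function.Injective (fun (i : Fin n) (j : Fin m) => a i j) := by
    intro i i' hii
    by_contra hne
    have hlt : d (i, i') < m := Nat.lt_succ_of_le (Finset.le_sup (Finset.mem_univ _))
    exact hd (i, i') hne (congrFun hii ⟨d (i, i'), hlt⟩)
  exact ⟨⟨m, Function.extend (fun (i : Fin n) (j : Fin m) => a i j) t (fun _ => 0)⟩,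
    fun i => hr.extend_apply t (fun _ => 0) i⟩

lemma aeval_coord {n : ℕ} (g : Fin n → LInf) (P : MvPolynomial (Fin n) ℝ) (k : ℕ) :
    (MvPolynomial.aeval g P : LInf) k = MvPolynomial.eval (fun i => g i k) P := by
  induction P using MvPolynomial.induction_on with
  | C r =>
    rw [MvPolynomial.aeval_C, MvPolynomial.eval_C, Algebra.algebraMap_eq_smul_one,
      lp.coeFn_smul, lp.infty_coeFn_one]
    simp
  | add p q hp hq => rw [map_add, map_add, lp.coeFn_add, Pi.add_apply, hp, hq]
  | mul_X p i hp =>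
    rw [map_mul, map_mul, lp.infty_coeFn_mul, Pi.mul_apply, hp, MvPolynomial.aeval_X,
      MvPolynomial.eval_X]

lemma block_tendsto (z : ℕ → ℝ) (l : ℝ)
    (h : Tendsto (fun n : ℕ => (∑ i ∈ Finset.range n, z (Nat.log 2 i)) / n) atTop (nhds l)) :
    Tendsto z atTop (nhds l) := by
  have hp : Tendsto (fun k : ℕ => 2 ^ k) atTop (atTop : Filter ℕ) :=
    tendsto_pow_atTop_atTop_of_one_lt (by norm_num)
  have h1 := h.comp hp
  have h2 := (tendsto_add_atTop_iff_nat 1).mpr h1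
  have h3 := (h2.const_mul 2).sub h1
  have e : 2 * l - l = l := by ring
  rw [e] at h3
  refine h3.congr (fun k => ?_)
  have hs : ∑ i ∈ Finset.range (2 ^ (k + 1)), z (Nat.log 2 i)
      = ∑ i ∈ Finset.range (2 ^ k), z (Nat.log 2 i) + 2 ^ k * z k := by
    rw [← Finset.sum_range_add_sum_Ico _ (Nat.pow_le_pow_right (by norm_num) (Nat.le_succ k))]
    congr 1
    rw [Finset.sum_congr rfl (g := fun _ => z k)]
    · rw [Finset.sum_const, Nat.card_Ico, nsmul_eq_mul]
      have : 2 ^ (k + 1) - 2 ^ k = 2 ^ k := by rw [pow_succ]; omega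
      rw [this]
      push_cast
      rfl
    · intro i hi
      rw [Finset.mem_Ico] at hi
      rw [Nat.log_eq_of_pow_le_of_lt_pow hi.1 hi.2]
  simp only [Function.comp_apply]
  rw [hs]
  push_cast
  rw [pow_succ]
  field_simp
  ring

lemma key {n : ℕ} (P : MvPolynomial (Fin n) ℝ) (hP : P ≠ 0) (h0 : MvPolynomial.coeff 0 P = 0)
    (a : Fin n → ℕ → Bool) (ha : Function.Injective a) (l : ℝ)
    (h : Tendsto (fun k : ℕ => (∑ i ∈ Finset.range k,
      (MvPolynomial.aeval (fun i => xGen (a i)) P : LInf) i) / k) atTop (nhds l)) : False := by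
  simp only [aeval_coord, xGen_apply] at h
  have hz := block_tendsto (fun k => MvPolynomial.eval (fun i => ySeq (a i) k) P) l h
  have hv : ∀ t : Fin n → ℕ, MvPolynomial.eval (fun i => 1 / ((t i : ℝ) + 1)) P = l := by
    intro t
    obtain ⟨c, hc⟩ := indep a ha t
    obtain ⟨q, hq⟩ := sIdx_surj c
    have ht : Tendsto (fun j => Nat.pair q j) atTop atTop :=
      tendsto_atTop_mono (fun j => Nat.right_le_pair q j) tendsto_id
    have := hz.comp ht
    refine tendsto_nhds_unique (tendsto_const_nhds.congr (fun j => ?_)) this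
    simp only [Function.comp_apply, ySeq_pair _ q j c hq, hc]
  have hT : (Set.range (fun m : ℕ => 1 / ((m : ℝ) + 1))).Infinite := by
    apply Set.infinite_range_of_injective
    intro m m' hm
    simpa using hm
  have hPC : P = MvPolynomial.C l := by
    refine MvPolynomial.funext_set (fun _ => Set.range (fun m : ℕ => 1 / ((m : ℝ) + 1)))
      (fun _ => hT) (fun x hx => ?_)
    have hx' : ∀ i, ∃ m : ℕ, 1 / ((m : ℝ) + 1) = x i := fun i => hx i (Set.mem_univ i)
    choose t ht using hx'
    have := hv t
    simp only [ht] at this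
    rw [this, MvPolynomial.eval_C]
  rw [hPC, MvPolynomial.coeff_zero_C] at h0
  apply hP
  rw [hPC, h0, map_zero]

lemma xGen_inj : Function.Injective xGen := by
  intro a b hab
  by_contra hne
  have hinj : Function.Injective ![a, b] := by
    intro i j hij
    fin_cases i <;> fin_cases j <;> simp_all [eq_comm]
  obtain ⟨c, hc⟩ := indep ![a, b] hinj ![0, 1]
  obtain ⟨q, hq⟩ := sIdx_surj c
  have h1 : xGen a (2 ^ Nat.pair q 0) = xGen b (2 ^ Nat.pair q 0) := by rw [hab]
  have c0 := hc 0
  have c1 := hc 1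
  simp only [Matrix.cons_val_zero, Matrix.cons_val_one] at c0 c1
  rw [xGen_apply, xGen_apply, Nat.log_pow (by norm_num)] at h1
  rw [ySeq_pair _ q 0 c hq, ySeq_pair _ q 0 c hq, c0, c1] at h1
  norm_num at h1

/-- The family `ℓ∞ \ S` of bounded sequences whose arithmetic means do not converge is
strongly `𝔠`-algebrable in `ℓ∞`. -/
theorem stmt15 :
    StronglyContinuumAlgebrable
      (Set.univ \ {x : LInf | ∃ l : ℝ,
        Tendsto (fun n : ℕ => (∑ i ∈ Finset.range n, x i) / n) atTop (nhds l)}) := by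
  have main : ∀ (n : ℕ) (P : MvPolynomial (Fin n) ℝ), P ≠ 0 → MvPolynomial.coeff 0 P = 0 →
      ∀ g : Fin n → LInf, (∀ i, g i ∈ Set.range xGen) → Function.Injective g →
        ¬ ∃ l : ℝ, Tendsto (fun k : ℕ => (∑ i ∈ Finset.range k,
          (MvPolynomial.aeval g P : LInf) i) / k) atTop (nhds l) := by
    intro n P hP h0 g hg hinj
    choose a ha using hg
    obtain rfl : (fun i => xGen (a i)) = g := funext ha
    rintro ⟨l, hl⟩
    exact key P hP h0 a (fun i j hij => hinj (congrArg xGen hij)) l hl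
  refine ⟨Set.range xGen, ?_, ?_, ?_⟩
  · intro x hx
    left
    refine ⟨Set.mem_univ _, ?_⟩
    have := main 1 (MvPolynomial.X 0) (MvPolynomial.X_ne_zero _) (by simp) (fun _ => x)
      (fun _ => hx) (fun i j _ => Subsingleton.elim i j)
    rwa [MvPolynomial.aeval_X] at this
  · rw [Cardinal.mk_range_eq _ xGen_inj]
    simp
  · intro n P hP h0 g hg hinj
    have := main n P hP h0 g hg hinj
    refine ⟨⟨Set.mem_univ _, this⟩, fun hz => this ⟨0, ?_⟩⟩
    rw [hz]
    simp
end
end
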